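/- arXiv:2512.08775 — 6 statements merged into one kernel-verified Lean document; each statement's English description precedes it below -/
import Mathlib

section
/- Let f : ℝⁿ → ℝ be twice continuously differentiable with L₂-Lipschitz Hessian, and let ρ : ℝⁿ → ℝ be twice continuously differentiable, σ_V-strongly convex, with L_V-Lipschitz gradient. Fix a point x_k with ∇f(x_k) ≠ 0, a symmetric matrix H_k, constants A_k ≥ 0, r_k > 0, and suppose d ∈ ℝⁿ and λ > 0 satisfy: (i) H_k d + λ d + A_k(∇ρ(x_k + d) − ∇ρ(x_k)) = −∇f(x_k); (ii) the matrix H_k + A_k ∇²ρ(x_k + d) + λI is positive semidefinite; (iii) ‖d‖ = r_k‖∇f(x_k)‖^{1/2}. Then f(x_k + d) − f(x_k) ≤ −(1/2)·( λ/(r_k‖∇f(x_k)‖^{1/2}) + (2σ_V − L_V)A_k/(r_k‖∇f(x_k)‖^{1/2}) − L₂/3 − ‖∇²f(x_k) − H_k‖/(r_k‖∇f(x_k)‖^{1/2}) )·r_k³‖∇f(x_k)‖^{3/2}. -/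
open RealInnerProductSpace

open Set

section Helpers

variable {E : Type*} [NormedAddCommGroup E] [InnerProductSpace ℝ E] [CompleteSpace E]

/-- A real function with nonpositive derivative on `[0, ∞)` stays below its value at `0`. -/
theorem le_zero_value_of_hasDerivAt_nonpos {h h' : ℝ → ℝ} (hd : ∀ t, HasDerivAt h (h' t) t)
    (hn : ∀ t, 0 ≤ t → h' t ≤ 0) {t : ℝ} (ht : 0 ≤ t) : h t ≤ h 0 := by
  have ha : AntitoneOn h (Ici 0) := by
    refine antitoneOn_of_hasDerivWithinAt_nonpos (convex_Ici 0)
      (fun x _ => (hd x).continuousAt.continuousWithinAt)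
      (fun x _ => (hd x).hasDerivWithinAt) (fun x hx => hn x ?_)
    exact interior_subset hx
  exact ha self_mem_Ici ht ht

/-- The gradient of a `C²` function is differentiable. -/
theorem ContDiff.differentiable_gradient {f : E → ℝ} (hf : ContDiff ℝ 2 f) :
    Differentiable ℝ (gradient f) := by
  have h1 : ContDiff ℝ 1 (fderiv ℝ f) := hf.fderiv_right (by norm_num)
  exact (InnerProductSpace.toDual ℝ E).symm.differentiable.comp (h1.differentiable (by norm_num))

/-- Cubic upper model of a `C²` function with Lipschitz Hessian. -/
theorem cubic_upper_bound {f : E → ℝ} {L : ℝ} (hf : ContDiff ℝ 2 f)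
    (hL : ∀ x y, ‖fderiv ℝ (gradient f) x - fderiv ℝ (gradient f) y‖ ≤ L * ‖x - y‖) (x d : E) :
    f (x + d) ≤ f x + ⟪gradient f x, d⟫ + 1 / 2 * ⟪fderiv ℝ (gradient f) x d, d⟫
      + L / 6 * ‖d‖ ^ 3 := by
  have hline : ∀ t : ℝ, HasDerivAt (fun t : ℝ => x + t • d) d t := fun t => by
    simpa using ((hasDerivAt_id t).smul_const d).const_add x
  have hval : ∀ t, HasDerivAt (fun t : ℝ => f (x + t • d)) ⟪gradient f (x + t • d), d⟫ t := by
    intro t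
    have h := ((hf.differentiable (by norm_num)) (x + t • d)).hasGradientAt.hasFDerivAt
    exact h.comp_hasDerivAt t (hline t)
  have hgrad : ∀ t, HasDerivAt (fun t : ℝ => ⟪gradient f (x + t • d), d⟫)
      ⟪fderiv ℝ (gradient f) (x + t • d) d, d⟫ t := by
    intro t
    have h := (hf.differentiable_gradient (x + t • d)).hasFDerivAt.comp_hasDerivAt t (hline t)
    simpa using h.inner ℝ (hasDerivAt_const t d)
  have hfirst : ∀ t, 0 ≤ t → ⟪gradient f (x + t • d), d⟫ - ⟪gradient f x, d⟫
      - t * ⟪fderiv ℝ (gradient f) x d, d⟫ - t ^ 2 * (L / 2 * ‖d‖ ^ 3) ≤ 0 := by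
    intro t ht
    have := le_zero_value_of_hasDerivAt_nonpos
      (h := fun t => ⟪gradient f (x + t • d), d⟫ - ⟪gradient f x, d⟫
        - t * ⟪fderiv ℝ (gradient f) x d, d⟫ - t ^ 2 * (L / 2 * ‖d‖ ^ 3))
      (fun s => (((hgrad s).sub_const _).sub ((hasDerivAt_id s).mul_const _)).sub
        ((hasDerivAt_pow 2 s).mul_const _)) (fun s hs => ?_) ht
    · simpa using this
    · have h1 : ⟪(fderiv ℝ (gradient f) (x + s • d) - fderiv ℝ (gradient f) x) d, d⟫
          ≤ L * (s * ‖d‖) * ‖d‖ * ‖d‖ := by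
        refine (real_inner_le_norm _ _).trans ?_
        gcongr
        refine (ContinuousLinearMap.le_opNorm _ _).trans ?_
        gcongr
        simpa [norm_smul, abs_of_nonneg hs] using hL (x + s • d) x
      rw [sub_apply, inner_sub_left] at h1
      norm_num
      linarith
  have := le_zero_value_of_hasDerivAt_nonpos
    (h := fun t => f (x + t • d) - t * ⟪gradient f x, d⟫
      - t ^ 2 * (1 / 2 * ⟪fderiv ℝ (gradient f) x d, d⟫) - t ^ 3 * (L / 6 * ‖d‖ ^ 3))
    (fun s => (((hval s).sub ((hasDerivAt_id s).mul_const _)).sub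
      ((hasDerivAt_pow 2 s).mul_const _)).sub ((hasDerivAt_pow 3 s).mul_const _))
    (fun s hs => ?_) zero_le_one
  · simp only [one_smul, zero_smul, add_zero] at this
    linarith
  · have := hfirst s hs
    simp only [Nat.cast_ofNat, Nat.add_one_sub_one, pow_one]
    linarith

end Helpers

/-- Sufficient decrease in function value when the trust-region constraint is active
(Lagrange multiplier `λ > 0`). -/
theorem stmt3 {n : ℕ} (f ρ : EuclideanSpace ℝ (Fin n) → ℝ) (L₂ σV LV : ℝ)
    (hf : ContDiff ℝ 2 f)
    (hfLip : ∀ x y, ‖fderiv ℝ (gradient f) x - fderiv ℝ (gradient f) y‖ ≤ L₂ * ‖x - y‖)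
    (hρ : ContDiff ℝ 2 ρ)
    (hsc : ∀ x y, ρ y ≥ ρ x + ⟪gradient ρ x, y - x⟫ + σV / 2 * ‖y - x‖ ^ 2)
    (hρlip : ∀ x y, ‖gradient ρ y - gradient ρ x‖ ≤ LV * ‖y - x‖)
    (xk : EuclideanSpace ℝ (Fin n)) (hxk : gradient f xk ≠ 0)
    (Hk : EuclideanSpace ℝ (Fin n) →L[ℝ] EuclideanSpace ℝ (Fin n))
    (hHsym : ∀ u v, ⟪Hk u, v⟫ = ⟪u, Hk v⟫)
    (Ak rk lam : ℝ) (hAk : 0 ≤ Ak) (hrk : 0 < rk) (hlam : 0 < lam)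
    (d : EuclideanSpace ℝ (Fin n))
    (hKKT1 : Hk d + lam • d + Ak • (gradient ρ (xk + d) - gradient ρ xk) = -gradient f xk)
    (hKKT2 : ∀ v, 0 ≤ ⟪Hk v + Ak • (fderiv ℝ (gradient ρ) (xk + d)) v + lam • v, v⟫)
    (hKKT3 : ‖d‖ = rk * Real.sqrt ‖gradient f xk‖) :
    f (xk + d) - f xk ≤
      -(1 / 2) * (lam / (rk * Real.sqrt ‖gradient f xk‖)
          + (2 * σV - LV) * Ak / (rk * Real.sqrt ‖gradient f xk‖)
          - L₂ / 3
          - ‖fderiv ℝ (gradient f) xk - Hk‖ / (rk * Real.sqrt ‖gradient f xk‖))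
        * rk ^ 3 * ‖gradient f xk‖ ^ ((3 : ℝ) / 2) := by
  set g := gradient f xk with hg
  have hgpos : 0 < ‖g‖ := norm_pos_iff.mpr hxk
  have hspos : 0 < Real.sqrt ‖g‖ := Real.sqrt_pos.mpr hgpos
  have hdpos : 0 < ‖d‖ := hKKT3 ▸ mul_pos hrk hspos
  have hLV : 0 ≤ LV := by
    have h := (norm_nonneg _).trans (hρlip xk (xk + d))
    rw [add_sub_cancel_left] at h
    exact nonneg_of_mul_nonneg_left h hdpos
  have hmono : σV * ‖d‖ ^ 2 ≤ ⟪gradient ρ (xk + d) - gradient ρ xk, d⟫ := by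
    have h1 := hsc xk (xk + d)
    have h2 := hsc (xk + d) xk
    rw [add_sub_cancel_left] at h1
    rw [sub_add_cancel_left, norm_neg, inner_neg_right] at h2
    rw [inner_sub_left]
    linarith
  have hcurv : ⟪fderiv ℝ (gradient ρ) (xk + d) d, d⟫ ≤ LV * ‖d‖ ^ 2 := by
    have hop : ‖fderiv ℝ (gradient ρ) (xk + d)‖ ≤ LV :=
      (hρ.differentiable_gradient (xk + d)).hasFDerivAt.le_of_lip' hLV
        (Filter.Eventually.of_forall fun y => hρlip (xk + d) y)
    calc _ ≤ ‖fderiv ℝ (gradient ρ) (xk + d) d‖ * ‖d‖ := real_inner_le_norm _ _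
      _ ≤ LV * ‖d‖ * ‖d‖ := by
        gcongr
        exact ContinuousLinearMap.le_of_opNorm_le _ hop d
      _ = LV * ‖d‖ ^ 2 := by ring
  have herr : ⟪fderiv ℝ (gradient f) xk d, d⟫ - ⟪Hk d, d⟫
      ≤ ‖fderiv ℝ (gradient f) xk - Hk‖ * ‖d‖ ^ 2 := by
    rw [← inner_sub_left, ← sub_apply]
    calc _ ≤ ‖(fderiv ℝ (gradient f) xk - Hk) d‖ * ‖d‖ := real_inner_le_norm _ _
      _ ≤ ‖fderiv ℝ (gradient f) xk - Hk‖ * ‖d‖ * ‖d‖ := by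
        gcongr
        exact ContinuousLinearMap.le_opNorm _ d
      _ = _ := by ring
  have hstat : ⟪Hk d, d⟫ + lam * ‖d‖ ^ 2 + Ak * ⟪gradient ρ (xk + d) - gradient ρ xk, d⟫
      = -⟪g, d⟫ := by
    have h := congrArg (fun v => ⟪v, d⟫) hKKT1
    simpa only [inner_add_left, real_inner_smul_left, inner_neg_left,
      real_inner_self_eq_norm_sq] using h
  have hpsd := hKKT2 d
  rw [inner_add_left, inner_add_left, real_inner_smul_left, real_inner_smul_left,
    real_inner_self_eq_norm_sq] at hpsd
  have hcubic := cubic_upper_bound hf hfLip xk d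
  rw [← hg] at hcubic
  have hAmono := mul_le_mul_of_nonneg_left hmono hAk
  have hAcurv := mul_le_mul_of_nonneg_left hcurv hAk
  have hpow : ‖g‖ ^ ((3 : ℝ) / 2) = Real.sqrt ‖g‖ ^ 3 := by
    rw [Real.sqrt_eq_rpow, ← Real.rpow_natCast, ← Real.rpow_mul hgpos.le]
    norm_num
  rw [hpow, mul_assoc, ← mul_pow, ← hKKT3]
  have hrhs : -(1 / 2) * (lam / ‖d‖ + (2 * σV - LV) * Ak / ‖d‖ - L₂ / 3
        - ‖fderiv ℝ (gradient f) xk - Hk‖ / ‖d‖) * ‖d‖ ^ 3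
      = -(1 / 2) * (lam + (2 * σV - LV) * Ak - ‖fderiv ℝ (gradient f) xk - Hk‖) * ‖d‖ ^ 2
        + L₂ / 6 * ‖d‖ ^ 3 := by
    field_simp
    ring
  rw [hrhs]
  linarith
end

section
/- Let f : ℝⁿ → ℝ be differentiable with finite infimum f_* = inf_x f(x), let η > 0, ξ ∈ (0, 1), G > 0, and 0 < ε ≤ G. Let (x_k)_{k≥0} be a sequence in ℝⁿ with f(x_{k+1}) ≤ f(x_k) for all k and ‖∇f(x_k)‖ ≤ G for all k, and suppose that for every k, either f(x_{k+1}) − f(x_k) ≤ −η‖∇f(x_k)‖^{3/2} or ‖∇f(x_{k+1})‖ ≤ ξ‖∇f(x_k)‖. Then for every index T such that ‖∇f(x_k)‖ ≥ ε for all k < T, one has T ≤ ((1/η)(f(x₀) − f_*)·ε^{−3/2} + 1)·(⌈log(G/ε)/log(1/ξ)⌉ + 1). In particular, an ε-approximate first-order stationary point (a point x with ‖∇f(x)‖ ≤ ε) is reached after O(ε^{−3/2}·log(1/ε)) iterations. -/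
open RealInnerProductSpace

/-- Bookkeeping behind the complexity bound: if the values `F k` do not increase, the quantities
`g k` start below `B`, and each step either lowers `F` by `c` or contracts `g`, where at most `M`
contractions can occur between two decreases, then after `t` steps one has counted `D` decreases
and `j` contractions since the last one. -/
theorem exists_decreases_and_contractions {F g : ℕ → ℝ} {c ξ B M : ℝ} {T : ℕ}
    (hM : 0 ≤ M) (hξ : 0 ≤ ξ) (hF : ∀ k, F (k + 1) ≤ F k) (hg : ∀ k, g k ≤ B)
    (hstep : ∀ k < T, F (k + 1) + c ≤ F k ∨ g (k + 1) ≤ ξ * g k)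
    (hrun : ∀ k < T, ∀ j : ℕ, g k ≤ ξ ^ j * B → (j : ℝ) ≤ M) :
    ∀ t ≤ T, ∃ D j : ℕ, (t : ℝ) ≤ D * (M + 1) + j ∧ (j : ℝ) ≤ M + 1 ∧
      D * c ≤ F 0 - F t ∧ g t ≤ ξ ^ j * B := by
  intro t
  induction t with
  | zero => exact fun _ => ⟨0, 0, by simp, by simpa using by linarith, by simp, by simpa using hg 0⟩
  | succ t ih =>
    intro ht
    obtain ⟨D, j, htD, -, hD, hgt⟩ := ih (by omega)
    have hj := hrun t (by omega) j hgt
    rcases hstep t (by omega) with h | h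
    · refine ⟨D + 1, 0, ?_, ?_, ?_, by simpa using hg (t + 1)⟩ <;> push_cast <;> linarith
    · refine ⟨D, j + 1, ?_, ?_, by linarith [hF t], ?_⟩
      · push_cast; linarith
      · push_cast; linarith
      · calc g (t + 1) ≤ ξ * g t := h
          _ ≤ ξ * (ξ ^ j * B) := by gcongr
          _ = ξ ^ (j + 1) * B := by ring

/-- The number of contractions by `ξ` that keep a quantity started at `B` above `ε`. -/
theorem natCast_le_log_div_log_of_le_pow_mul {ξ B ε : ℝ} (hξ0 : 0 < ξ) (hξ1 : ξ < 1)
    (hε : 0 < ε) {j : ℕ} (h : ε ≤ ξ ^ j * B) :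
    (j : ℝ) ≤ Real.log (B / ε) / Real.log (1 / ξ) := by
  have hlog : 0 < Real.log (1 / ξ) := Real.log_pos (one_lt_one_div hξ0 hξ1)
  rw [le_div_iff₀ hlog, ← Real.log_pow]
  refine Real.log_le_log (by positivity) ?_
  rw [one_div, inv_pow, inv_eq_one_div, div_le_div_iff₀ (by positivity) hε]
  linarith

/-- Nonconvex complexity of the HAT method: under the per-iteration dichotomy
(sufficient value decrease or gradient contraction), any stretch of iterations on which
the gradient norm stays at least `ε` has length at most
`((1/η)(f(x₀) − f_*)ε^{−3/2} + 1)(⌈log(G/ε)/log(1/ξ)⌉ + 1)`, i.e. an `ε`-approximate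
first-order stationary point is reached after `O(ε^{−3/2} log(1/ε))` iterations. -/
theorem stmt9 {n : ℕ} (f : EuclideanSpace ℝ (Fin n) → ℝ) (fstar η ξ Gb ε : ℝ)
    (hdiff : Differentiable ℝ f)
    (hbdd : BddBelow (Set.range f)) (hfstar : fstar = ⨅ x, f x)
    (hη : 0 < η) (hξ0 : 0 < ξ) (hξ1 : ξ < 1) (hGb : 0 < Gb) (hε0 : 0 < ε) (hεG : ε ≤ Gb)
    (x : ℕ → EuclideanSpace ℝ (Fin n))
    (hmono : ∀ k, f (x (k + 1)) ≤ f (x k))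
    (hbound : ∀ k, ‖gradient f (x k)‖ ≤ Gb)
    (hdich : ∀ k,
      f (x (k + 1)) - f (x k) ≤ -η * ‖gradient f (x k)‖ ^ ((3 : ℝ) / 2) ∨
      ‖gradient f (x (k + 1))‖ ≤ ξ * ‖gradient f (x k)‖) :
    ∀ T : ℕ, (∀ k < T, ε ≤ ‖gradient f (x k)‖) →
      (T : ℝ) ≤ (1 / η * (f (x 0) - fstar) * ε ^ (-(3 : ℝ) / 2) + 1)
        * ((⌈Real.log (Gb / ε) / Real.log (1 / ξ)⌉ : ℝ) + 1) := by
  intro T hT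
  set L := Real.log (Gb / ε) / Real.log (1 / ξ) with hL
  have hL0 : 0 ≤ L := div_nonneg (Real.log_nonneg ((one_le_div hε0).2 hεG))
    (Real.log_nonneg (one_lt_one_div hξ0 hξ1).le)
  have hLM : L ≤ (⌈L⌉ : ℝ) := Int.le_ceil L
  have hpow : 0 < ε ^ ((3 : ℝ) / 2) := Real.rpow_pos_of_pos hε0 _
  obtain ⟨D, j, hTD, hj, hD, -⟩ := exists_decreases_and_contractions
    (F := fun k => f (x k)) (g := fun k => ‖gradient f (x k)‖)
    (c := η * ε ^ ((3 : ℝ) / 2)) (M := (⌈L⌉ : ℝ)) (T := T)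
    (hL0.trans hLM) hξ0.le hmono hbound
    (fun k hk => (hdich k).imp_left fun h => by
      have : η * ε ^ ((3 : ℝ) / 2) ≤ η * ‖gradient f (x k)‖ ^ ((3 : ℝ) / 2) := by
        gcongr
        exact hT k hk
      linarith)
    (fun k hk j h =>
      (natCast_le_log_div_log_of_le_pow_mul hξ0 hξ1 hε0 ((hT k hk).trans h)).trans hLM)
    T le_rfl
  have hstar : fstar ≤ f (x T) := hfstar ▸ ciInf_le hbdd (x T)
  have hDle : (D : ℝ) ≤ 1 / η * (f (x 0) - fstar) * ε ^ (-(3 : ℝ) / 2) := by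
    rw [neg_div, Real.rpow_neg hε0.le, ← div_eq_mul_inv, le_div_iff₀ hpow, one_div_mul_eq_div,
      le_div_iff₀ hη]
    linarith
  calc (T : ℝ) ≤ (D + 1) * ((⌈L⌉ : ℝ) + 1) := by linarith
    _ ≤ _ := by gcongr
end

section
/- Let f : ℝⁿ → ℝ be differentiable and convex with a global minimizer x_* and minimum value f_* = f(x_*), let η > 0, D > 0, and ε > 0. Let (x_k)_{k≥0} be a sequence in ℝⁿ with f(x_{k+1}) ≤ f(x_k) for all k and ‖x_k − x_*‖ ≤ D for all k. Let j_f be an index such that f(x_k) − f_* ≥ ε for all k < j_f, and let F = {k < j_f : f(x_{k+1}) − f(x_k) ≤ −η‖∇f(x_k)‖^{3/2}}. Then |F| ≤ √(4D³/(ε η²)). -/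
open RealInnerProductSpace

section CubicDecrease

variable {s : ℕ → ℝ} {c : ℝ} {p : ℕ → Prop} [DecidablePred p]

/-- If `s` is nonnegative and antitone, and `s ^ 2` drops by at least `c * s ^ 3` at every index
satisfying `p`, then `s j` is at most of order `1 / (c * #{k < j | p k})`. -/
theorem count_mul_le_two_of_cubic_decrease (hc : 0 < c) (hs : ∀ k, 0 ≤ s k)
    (hanti : ∀ k, s (k + 1) ≤ s k)
    (hdec : ∀ k, p k → c * s k ^ 3 ≤ s k ^ 2 - s (k + 1) ^ 2) (j : ℕ) :
    Nat.count p j = 0 ∨ ((Nat.count p j : ℝ) + 1) * c * s j ≤ 2 := by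
  induction j with
  | zero => simp
  | succ j ih =>
    by_cases hp : p j
    · right
      rw [Nat.count_succ, if_pos hp]
      push_cast
      have hj := hdec j hp
      have ha := hanti j
      have ht := hs (j + 1)
      rcases (hs j).eq_or_lt with h0 | h0
      · have : s (j + 1) = 0 := by linarith
        simp [this]
      rcases ih with h | h
      · rw [h]
        have h1 : c * s j ≤ 1 := by
          have : s j ^ 2 * (c * s j) ≤ s j ^ 2 * 1 := by nlinarith
          exact le_of_mul_le_mul_left this (by positivity)
        have h2 : c * s (j + 1) ≤ c * s j := by gcongr
        push_cast
        linarith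
      · have h1 : c * s j ^ 2 ≤ 2 * (s j - s (j + 1)) := by
          have : s j * (c * s j ^ 2) ≤ s j * (2 * (s j - s (j + 1))) := by nlinarith
          exact le_of_mul_le_mul_left this h0
        have h2 : c * s j * s (j + 1) ≤ c * s j * s j := by gcongr
        have h3 : ((Nat.count p j : ℝ) + 1) * c * s j * s (j + 1) ≤ 2 * s (j + 1) := by gcongr
        have : s j * (((Nat.count p j : ℝ) + 1 + 1) * c * s (j + 1)) ≤ s j * 2 := by nlinarith
        exact le_of_mul_le_mul_left this h0
    · rw [Nat.count_succ, if_neg hp, add_zero]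
      refine ih.imp_right fun h => le_trans ?_ h
      gcongr
      exact hanti j

/-- Under cubic decrease, the number of decrease steps taken while `s` stays above `σ` is at most
`2 / (c * σ)`. -/
theorem count_mul_lower_bound_le_two (hc : 0 < c) (hs : ∀ k, 0 ≤ s k)
    (hanti : ∀ k, s (k + 1) ≤ s k)
    (hdec : ∀ k, p k → c * s k ^ 3 ≤ s k ^ 2 - s (k + 1) ^ 2) {σ : ℝ} (hσ : 0 < σ) (j : ℕ)
    (hlow : ∀ k < j, σ ≤ s k) :
    (Nat.count p j : ℝ) * c * σ ≤ 2 := by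
  induction j with
  | zero => simp
  | succ j ih =>
    by_cases hp : p j
    · rw [Nat.count_succ, if_pos hp]
      push_cast
      have hσj := hlow j j.lt_succ_self
      have h0 : 0 < s j := hσ.trans_le hσj
      refine le_trans (mul_le_mul_of_nonneg_left hσj (by positivity)) ?_
      rcases count_mul_le_two_of_cubic_decrease hc hs hanti hdec j with h | h
      · have : s j ^ 2 * (c * s j) ≤ s j ^ 2 * 1 := by
          nlinarith [hdec j hp, sq_nonneg (s (j + 1))]
        have := le_of_mul_le_mul_left this (by positivity)
        rw [h]
        push_cast
        linarith
      · exact h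
    · rw [Nat.count_succ, if_neg hp, add_zero]
      exact ih fun k hk => hlow k (hk.trans j.lt_succ_self)

end CubicDecrease

/-- In the convex case, the number of iterations with sufficient decrease in function value
before the first iteration with `f(x_k) − f_* < ε` is at most `√(4D³/(εη²))`. -/
theorem stmt10 {n : ℕ} (f : EuclideanSpace ℝ (Fin n) → ℝ)
    (xstar : EuclideanSpace ℝ (Fin n)) (fstar η D ε : ℝ)
    (hdiff : Differentiable ℝ f)
    (hconv : ∀ x y, f y ≥ f x + ⟪gradient f x, y - x⟫)
    (hmin : ∀ y, f xstar ≤ f y) (hfstar : fstar = f xstar)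
    (hη : 0 < η) (hD : 0 < D) (hε : 0 < ε)
    (x : ℕ → EuclideanSpace ℝ (Fin n))
    (hmono : ∀ k, f (x (k + 1)) ≤ f (x k))
    (hdist : ∀ k, ‖x k - xstar‖ ≤ D)
    (jf : ℕ) (hgap : ∀ k < jf, ε ≤ f (x k) - fstar) :
    (({k | k < jf ∧
        f (x (k + 1)) - f (x k) ≤ -η * ‖gradient f (x k)‖ ^ ((3 : ℝ) / 2)}.ncard : ℝ))
      ≤ Real.sqrt (4 * D ^ 3 / (ε * η ^ 2)) := by
  classical
  subst hfstar
  set p : ℕ → Prop := fun k =>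
    f (x (k + 1)) - f (x k) ≤ -η * ‖gradient f (x k)‖ ^ ((3 : ℝ) / 2) with hp
  have hcard : {k | k < jf ∧ p k}.ncard = Nat.count p jf := by
    rw [Nat.count_eq_card_filter_range, ← Set.ncard_coe_finset]
    congr 1
    ext k
    simp
  change (({k | k < jf ∧ p k}.ncard : ℕ) : ℝ) ≤ _
  rw [hcard]
  have hgap_nonneg : ∀ k, 0 ≤ f (x k) - f xstar := fun k => sub_nonneg.2 (hmin _)
  have hd : 0 < √D := Real.sqrt_pos.2 hD
  have hdec : ∀ k, p k → η / √D ^ 3 * √(f (x k) - f xstar) ^ 3 ≤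
      √(f (x k) - f xstar) ^ 2 - √(f (x (k + 1)) - f xstar) ^ 2 := by
    intro k hk
    rw [Real.sq_sqrt (hgap_nonneg k), Real.sq_sqrt (hgap_nonneg (k + 1))]
    have hG : ‖gradient f (x k)‖ ^ ((3 : ℝ) / 2) = √‖gradient f (x k)‖ ^ 3 := by
      rw [Real.sqrt_eq_rpow, ← Real.rpow_natCast, ← Real.rpow_mul (norm_nonneg _)]
      norm_num
    have hgrad : f (x k) - f xstar ≤ ‖gradient f (x k)‖ * D := by
      have h1 := hconv (x k) xstar
      have h2 := neg_le_of_abs_le (abs_real_inner_le_norm (gradient f (x k)) (xstar - x k))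
      rw [norm_sub_rev] at h2
      have h3 := mul_le_mul_of_nonneg_left (hdist k) (norm_nonneg (gradient f (x k)))
      linarith
    have hsqrt : √(f (x k) - f xstar) ≤ √‖gradient f (x k)‖ * √D := by
      rw [← Real.sqrt_mul (norm_nonneg _)]
      exact Real.sqrt_le_sqrt hgrad
    have hcube : √(f (x k) - f xstar) ^ 3 ≤ √‖gradient f (x k)‖ ^ 3 * √D ^ 3 := by
      rw [← mul_pow]
      gcongr
    simp only [hp, hG] at hk
    calc η / √D ^ 3 * √(f (x k) - f xstar) ^ 3
        ≤ η / √D ^ 3 * (√‖gradient f (x k)‖ ^ 3 * √D ^ 3) := by gcongr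
      _ = η * √‖gradient f (x k)‖ ^ 3 := by field_simp
      _ ≤ f (x k) - f xstar - (f (x (k + 1)) - f xstar) := by linarith
  have hcount := count_mul_lower_bound_le_two (s := fun k => √(f (x k) - f xstar))
    (by positivity) (fun _ => Real.sqrt_nonneg _)
    (fun k => Real.sqrt_le_sqrt (sub_le_sub_right (hmono k) _)) hdec
    (Real.sqrt_pos.2 hε) jf (fun k hk => Real.sqrt_le_sqrt (hgap k hk))
  apply Real.le_sqrt_of_sq_le
  rw [le_div_iff₀ (by positivity)]
  have hbound : (Nat.count p jf : ℝ) * η * √ε ≤ 2 * √D ^ 3 := by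
    rw [← div_le_iff₀ (by positivity)]
    refine le_of_eq_of_le ?_ hcount
    ring
  calc (Nat.count p jf : ℝ) ^ 2 * (ε * η ^ 2)
      = ((Nat.count p jf : ℝ) * η * √ε) ^ 2 := by
        rw [mul_pow, Real.sq_sqrt hε.le]
        ring
    _ ≤ (2 * √D ^ 3) ^ 2 := by gcongr
    _ = 4 * (√D ^ 2) ^ 3 := by ring
    _ = 4 * D ^ 3 := by rw [Real.sq_sqrt hD.le]
end

section
/- Let f : ℝⁿ → ℝ be differentiable and convex with a global minimizer x_* and minimum value f_*, let η > 0, ξ ∈ (0, 1), D > 0, ε > 0, and ∇f(x₀) ≠ 0. Let (x_k)_{k≥0} be a sequence with f(x_{k+1}) ≤ f(x_k) and ‖x_k − x_*‖ ≤ D for all k, and suppose that for every k, either (a) f(x_{k+1}) − f(x_k) ≤ −η‖∇f(x_k)‖^{3/2} and ‖∇f(x_{k+1})‖ ≤ (1/ξ)‖∇f(x_k)‖, or (b) ‖∇f(x_{k+1})‖ ≤ ξ‖∇f(x_k)‖. Then every index T with f(x_k) − f_* ≥ ε for all k ≤ T satisfies T ≤ 2√(4D³/(ε η²)) + log_{1/ξ}(‖∇f(x₀)‖·D/ε).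 In particular, an ε-approximate zero-order stationary point (a point x with f(x) − f_* ≤ ε) is reached after O(ε^{−1/2} + log(1/ε)) iterations. -/
open RealInnerProductSpace

/-- A decrease of `u ^ 2` by at least `c * u ^ 3` increases `1 / u` by at least `c / 2`. -/
lemma mul_two_add_mul_le_of_sq_le {u v c : ℝ} (hu : 0 < u) (hv : 0 < v) (hc : 0 < c)
    (h : v ^ 2 ≤ u ^ 2 - c * u ^ 3) : v * (2 + c * u) ≤ 2 * u := by
  have hcu : c * u < 1 := by
    have h1 : 0 < u ^ 2 * (1 - c * u) := by nlinarith [pow_pos hv 2]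
    linarith [(pos_iff_pos_of_mul_pos h1).1 (by positivity)]
  have hle : v ≤ u * (1 - c * u / 2) := by
    refine le_of_sq_le_sq ?_ (mul_nonneg hu.le (by linarith))
    nlinarith [sq_nonneg (c * u ^ 2)]
  calc v * (2 + c * u) ≤ u * (1 - c * u / 2) * (2 + c * u) := by gcongr
    _ ≤ 2 * u := by nlinarith [mul_pos hu (pow_pos (mul_pos hc hu) 2)]

/-- Counting form of the dichotomy for an optimality gap `δ` and a gradient norm `g`: here `a`
is the number of steps among the first `k` at which the gap decreases. -/
lemma exists_count_of_dichotomy {δ g : ℕ → ℝ} {η ξ D : ℝ} {T : ℕ}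
    (hη : 0 < η) (hξ0 : 0 < ξ) (hD : 0 < D)
    (hδ : ∀ k ≤ T, 0 < δ k) (hg : ∀ k, δ k ≤ g k * D) (hmono : ∀ k, δ (k + 1) ≤ δ k)
    (hdich : ∀ k, (δ (k + 1) - δ k ≤ -η * g k ^ ((3 : ℝ) / 2) ∧ g (k + 1) ≤ 1 / ξ * g k) ∨
      g (k + 1) ≤ ξ * g k) :
    ∀ k ≤ T, ∃ a : ℕ, a * (η / √D ^ 3) * √(δ k) ≤ 2 ∧
      Real.log (g k) ≤ Real.log (g 0) - (k - 2 * a) * Real.log (1 / ξ) := by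
  have hgpos : ∀ k ≤ T, 0 < g k := fun k hk =>
    pos_of_mul_pos_left ((hδ k hk).trans_le (hg k)) hD.le
  have hsD : 0 < √D := Real.sqrt_pos.2 hD
  intro k
  induction k with
  | zero => exact fun _ => ⟨0, by simp, by simp⟩
  | succ k ih =>
    intro hk
    obtain ⟨a, ha, hlog⟩ := ih (by omega)
    have hδk := hδ k (by omega)
    have hgk := hgpos k (by omega)
    have hgk' := hgpos (k + 1) hk
    rcases hdich k with ⟨hdec, hgrow⟩ | hcontr
    · refine ⟨a + 1, ?_, ?_⟩
      · set c := η / √D ^ 3 with hc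
        have hcpos : 0 < c := by positivity
        have hs : 0 < √(δ k) := Real.sqrt_pos.2 hδk
        have hs' : 0 < √(δ (k + 1)) := Real.sqrt_pos.2 (hδ _ hk)
        have hpow : c * √(δ k) ^ 3 ≤ η * g k ^ ((3 : ℝ) / 2) := by
          have hrpow : g k ^ ((3 : ℝ) / 2) = √(g k) ^ 3 := by
            rw [Real.sqrt_eq_rpow, ← Real.rpow_natCast, ← Real.rpow_mul hgk.le]
            norm_num
          have hle : √(δ k) ≤ √(g k) * √D := by
            rw [← Real.sqrt_mul hgk.le]
            exact Real.sqrt_le_sqrt (hg k)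
          rw [hrpow, hc, div_mul_eq_mul_div, div_le_iff₀ (by positivity), mul_assoc, ← mul_pow]
          gcongr
        have hstep := mul_two_add_mul_le_of_sq_le hs hs' hcpos (by
          rw [Real.sq_sqrt hδk.le, Real.sq_sqrt (hδ _ hk).le]
          linarith)
        refine le_of_mul_le_mul_right ?_ hs
        push_cast
        nlinarith [mul_le_mul_of_nonneg_right ha hs'.le]
      · have h := Real.log_le_log hgk' hgrow
        rw [Real.log_mul (by positivity) hgk.ne'] at h
        push_cast
        linarith
    · refine ⟨a, le_trans ?_ ha, ?_⟩
      · have := Real.sqrt_le_sqrt (hmono k)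
        gcongr
      · have h := Real.log_le_log hgk' hcontr
        rw [Real.log_mul hξ0.ne' hgk.ne'] at h
        rw [one_div, Real.log_inv] at hlog ⊢
        push_cast
        linarith

/-- Convex complexity of the HAT method: under the per-iteration dichotomy, any index `T`
up to which the optimality gap stays at least `ε` satisfies
`T ≤ 2√(4D³/(εη²)) + log_{1/ξ}(‖∇f(x₀)‖D/ε)`, i.e. an `ε`-approximate zero-order
stationary point is reached after `O(ε^{−1/2} + log(1/ε))` iterations. -/
theorem stmt12 {n : ℕ} (f : EuclideanSpace ℝ (Fin n) → ℝ)
    (xstar : EuclideanSpace ℝ (Fin n)) (fstar η ξ D ε : ℝ)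
    (hdiff : Differentiable ℝ f)
    (hconv : ∀ x y, f y ≥ f x + ⟪gradient f x, y - x⟫)
    (hmin : ∀ y, f xstar ≤ f y) (hfstar : fstar = f xstar)
    (hη : 0 < η) (hξ0 : 0 < ξ) (hξ1 : ξ < 1) (hD : 0 < D) (hε : 0 < ε)
    (x : ℕ → EuclideanSpace ℝ (Fin n))
    (hx0 : gradient f (x 0) ≠ 0)
    (hmono : ∀ k, f (x (k + 1)) ≤ f (x k))
    (hdist : ∀ k, ‖x k - xstar‖ ≤ D)
    (hdich : ∀ k,
      (f (x (k + 1)) - f (x k) ≤ -η * ‖gradient f (x k)‖ ^ ((3 : ℝ) / 2) ∧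
        ‖gradient f (x (k + 1))‖ ≤ 1 / ξ * ‖gradient f (x k)‖) ∨
      ‖gradient f (x (k + 1))‖ ≤ ξ * ‖gradient f (x k)‖) :
    ∀ T : ℕ, (∀ k ≤ T, ε ≤ f (x k) - fstar) →
      (T : ℝ) ≤ 2 * Real.sqrt (4 * D ^ 3 / (ε * η ^ 2))
        + Real.log (‖gradient f (x 0)‖ * D / ε) / Real.log (1 / ξ) := by
  intro T hT
  have hgap : ∀ k, f (x k) - fstar ≤ ‖gradient f (x k)‖ * D := fun k => by
    have h1 := hconv (x k) xstar
    have h2 := neg_le_of_abs_le (abs_real_inner_le_norm (gradient f (x k)) (xstar - x k))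
    rw [norm_sub_rev] at h2
    have h3 := mul_le_mul_of_nonneg_left (hdist k) (norm_nonneg (gradient f (x k)))
    linarith
  obtain ⟨a, ha, hlog⟩ := exists_count_of_dichotomy (δ := fun k => f (x k) - fstar)
    (g := fun k => ‖gradient f (x k)‖) hη hξ0 hD (fun k hk => hε.trans_le (hT k hk)) hgap
    (fun k => sub_le_sub_right (hmono k) _)
    (fun k => by simpa only [sub_sub_sub_cancel_right] using hdich k) T le_rfl
  have hcount : (a : ℝ) ≤ √(4 * D ^ 3 / (ε * η ^ 2)) := by
    apply Real.le_sqrt_of_sq_le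
    have hle : a * (η / √D ^ 3) * √ε ≤ 2 :=
      le_trans (by have := Real.sqrt_le_sqrt (hT T le_rfl); gcongr) ha
    have hsq := pow_le_pow_left₀ (by positivity) hle 2
    have hD3 : (√D ^ 3) ^ 2 = D ^ 3 := by
      rw [← pow_mul, mul_comm, pow_mul, Real.sq_sqrt hD.le]
    rw [mul_pow, mul_pow, div_pow, hD3, Real.sq_sqrt hε.le, mul_div_assoc', div_mul_eq_mul_div,
      div_le_iff₀ (by positivity)] at hsq
    rw [le_div_iff₀ (by positivity)]
    linarith
  have hℓ : 0 < Real.log (1 / ξ) := Real.log_pos (by rwa [lt_div_iff₀ hξ0, one_mul])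
  have hg0 : 0 < ‖gradient f (x 0)‖ := norm_pos_iff.2 hx0
  have hlower : Real.log (ε / D) ≤ Real.log ‖gradient f (x T)‖ :=
    Real.log_le_log (by positivity) ((div_le_iff₀ hD).2 ((hT T le_rfl).trans (hgap T)))
  have hexcess : (T : ℝ) - 2 * a ≤
      Real.log (‖gradient f (x 0)‖ * D / ε) / Real.log (1 / ξ) := by
    rw [le_div_iff₀ hℓ, mul_div_assoc, Real.log_mul hg0.ne' (by positivity), ← inv_div ε D,
      Real.log_inv]
    linarith
  linarith
end

section
/- Let N ≥ 1, and for i = 1, …, N let φᵢ : ℝⁿ → ℝ be twice continuously differentiable with ‖∇²φᵢ(x)‖ ≤ L for all x ∈ ℝⁿ, and let bᵢ ∈ ℝ. Define f(x) = (1/2)·Σᵢ₌₁ᴺ (φᵢ(x) − bᵢ)² and H(x) = Σᵢ₌₁ᴺ ∇φᵢ(x)∇φᵢ(x)ᵀ. Suppose f is star-convex with respect to a global minimizer x_*, i.e. f(x_*) ≥ f(x) + ⟨∇f(x), x_* − x⟩ for all x ∈ ℝⁿ. Then for every x ∈ ℝⁿ, ‖∇²f(x) − H(x)‖ ≤ L·√(2N·‖∇f(x)‖·‖x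 − x_*‖) + L·√(2N·f(x_*)). -/
open RealInnerProductSpace

section Gradient

variable {E : Type*} [NormedAddCommGroup E] [InnerProductSpace ℝ E] [CompleteSpace E]

/-- The gradient of a `C²` function is differentiable. -/
theorem differentiable_gradient_of_contDiff_two {g : E → ℝ} (hg : ContDiff ℝ 2 g) :
    Differentiable ℝ (gradient g) := by
  let T : StrongDual ℝ E →L[ℝ] E :=
    { toFun := (InnerProductSpace.toDual ℝ E).symm
      map_add' := fun x y => map_add _ x y
      map_smul' := fun c x => by simp
      cont := (InnerProductSpace.toDual ℝ E).symm.continuous }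
  have hd : Differentiable ℝ (fderiv ℝ g) :=
    (hg.fderiv_right (m := 1) (by norm_num)).differentiable (by norm_num)
  exact T.differentiable.comp hd

/-- The gradient of a least-squares objective is the residual-weighted sum of the gradients. -/
theorem gradient_half_sum_sq {ι : Type*} [Fintype ι] {φ : ι → E → ℝ} {b : ι → ℝ} {x : E}
    (hφ : ∀ i, DifferentiableAt ℝ (φ i) x) :
    gradient (fun y => 1 / 2 * ∑ i, (φ i y - b i) ^ 2) x
      = ∑ i, (φ i x - b i) • gradient (φ i) x := by
  refine HasGradientAt.gradient (hasGradientAt_iff_hasFDerivAt.2 ?_)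
  have h := (HasFDerivAt.fun_sum (u := Finset.univ) fun i _ =>
    (((hφ i).hasGradientAt.hasFDerivAt.sub_const (b i)).pow 2)).const_mul (1 / 2)
  refine h.congr_fderiv ?_
  ext v
  simp only [map_sum, map_smul, toDual_gradient, sum_apply, smul_apply,
    smul_eq_mul, Finset.smul_sum, nsmul_eq_mul]
  refine Finset.sum_congr rfl fun i _ => ?_
  norm_num
  ring

/-- The Hessian of a least-squares objective, applied to a vector. -/
theorem fderiv_sum_smul_gradient_apply {ι : Type*} [Fintype ι] {φ : ι → E → ℝ} {b : ι → ℝ}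
    (hφ : ∀ i, ContDiff ℝ 2 (φ i)) (x v : E) :
    fderiv ℝ (fun y => ∑ i, (φ i y - b i) • gradient (φ i) y) x v
      = ∑ i, (φ i x - b i) • fderiv ℝ (gradient (φ i)) x v
        + ∑ i, ⟪gradient (φ i) x, v⟫ • gradient (φ i) x := by
  have hd i : DifferentiableAt ℝ (φ i) x := ((hφ i).differentiable (by norm_num)) x
  have h := HasFDerivAt.fun_sum (u := Finset.univ) fun i _ =>
    ((hd i).hasGradientAt.hasFDerivAt.sub_const (b i)).smul
      (differentiable_gradient_of_contDiff_two (hφ i) x).hasFDerivAt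
  have h2 := h.fderiv
  simp only [Pi.smul_apply'] at h2
  rw [h2]
  simp [Finset.sum_add_distrib]

end Gradient

/-- Sums of absolute values are bounded by the square root of cardinality times sum of squares. -/
theorem sum_abs_le_sqrt_card_mul_sum_sq {ι : Type*} [Fintype ι] (r : ι → ℝ) :
    ∑ i, |r i| ≤ Real.sqrt (Fintype.card ι * ∑ i, r i ^ 2) := by
  refine Real.le_sqrt_of_sq_le ?_
  simpa using sq_sum_le_card_mul_sum_sq (s := Finset.univ) (f := fun i => |r i|)

/-- Gauss–Newton approximation error for star-convex least-squares objectives: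
`‖∇²f(x) − H(x)‖ ≤ L√(2N‖∇f(x)‖‖x − x_*‖) + L√(2N f(x_*))`. -/
theorem stmt14 {n : ℕ} (N : ℕ) (hN : 1 ≤ N) (L : ℝ)
    (φ : Fin N → EuclideanSpace ℝ (Fin n) → ℝ) (b : Fin N → ℝ)
    (hφ : ∀ i, ContDiff ℝ 2 (φ i))
    (hHessφ : ∀ i x, ‖fderiv ℝ (gradient (φ i)) x‖ ≤ L)
    (f : EuclideanSpace ℝ (Fin n) → ℝ)
    (hfdef : ∀ x, f x = 1 / 2 * ∑ i, (φ i x - b i) ^ 2)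
    (H : EuclideanSpace ℝ (Fin n) →
      EuclideanSpace ℝ (Fin n) →L[ℝ] EuclideanSpace ℝ (Fin n))
    (hHdef : ∀ x v, H x v = ∑ i, ⟪gradient (φ i) x, v⟫ • gradient (φ i) x)
    (xstar : EuclideanSpace ℝ (Fin n)) (hmin : ∀ y, f xstar ≤ f y)
    (hstar : ∀ x, f xstar ≥ f x + ⟪gradient f x, xstar - x⟫) :
    ∀ x, ‖fderiv ℝ (gradient f) x - H x‖
      ≤ L * Real.sqrt (2 * N * ‖gradient f x‖ * ‖x - xstar‖)
        + L * Real.sqrt (2 * N * f xstar) := by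
  intro x
  have hL : 0 ≤ L := (norm_nonneg _).trans (hHessφ ⟨0, hN⟩ x)
  have hgrad : gradient f = fun y => ∑ i, (φ i y - b i) • gradient (φ i) y := by
    funext y
    rw [funext hfdef]
    exact gradient_half_sum_sq fun i => ((hφ i).differentiable (by norm_num)) y
  have hdiff : fderiv ℝ (gradient f) x - H x
      = ∑ i, (φ i x - b i) • fderiv ℝ (gradient (φ i)) x := by
    ext1 v
    rw [hgrad, sub_apply, fderiv_sum_smul_gradient_apply hφ, hHdef,
      add_sub_cancel_right]
    simp
  have hf : f x ≤ ‖gradient f x‖ * ‖x - xstar‖ + f xstar := by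
    have h1 := hstar x
    have h2 := abs_le.1 (abs_real_inner_le_norm (gradient f x) (xstar - x))
    rw [norm_sub_rev xstar x] at h2
    linarith [h2.1]
  have hnorm : ‖fderiv ℝ (gradient f) x - H x‖ ≤ L * ∑ i, |φ i x - b i| := by
    rw [hdiff, Finset.mul_sum]
    refine norm_sum_le_of_le _ fun i _ => ?_
    rw [norm_smul, Real.norm_eq_abs, mul_comm]
    exact mul_le_mul_of_nonneg_right (hHessφ i x) (abs_nonneg _)
  have hsum : ∑ i, |φ i x - b i| ≤ Real.sqrt (2 * N * f x) := by
    refine (sum_abs_le_sqrt_card_mul_sum_sq _).trans_eq ?_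
    rw [hfdef, Fintype.card_fin]
    congr 1
    ring
  rw [← mul_add]
  refine hnorm.trans (mul_le_mul_of_nonneg_left (hsum.trans ?_) hL)
  have hfs : 0 ≤ f xstar := by rw [hfdef]; positivity
  have hbound : 2 * N * f x
      ≤ 2 * N * ‖gradient f x‖ * ‖x - xstar‖ + 2 * N * f xstar := by
    calc 2 * N * f x ≤ 2 * N * (‖gradient f x‖ * ‖x - xstar‖ + f xstar) := by gcongr
      _ = _ := by ring
  refine Real.sqrt_le_iff.2 ⟨by positivity, hbound.trans ?_⟩
  rw [add_sq, Real.sq_sqrt (by positivity), Real.sq_sqrt (by positivity)]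
  have := mul_nonneg (Real.sqrt_nonneg (2 * N * ‖gradient f x‖ * ‖x - xstar‖))
    (Real.sqrt_nonneg (2 * N * f xstar))
  linarith
end

section
/- Let N ≥ 1, c ≥ 1, and for i = 1, …, N let φᵢ : ℝⁿ → ℝᶜ have twice continuously differentiable components with ‖∇²(φᵢ)ⱼ(x)‖ ≤ L for all x ∈ ℝⁿ and all j ∈ {1, …, c}, and let bᵢ ∈ {1, …, c}. For x ∈ ℝⁿ let pᵢ(x) ∈ ℝᶜ be the softmax vector pᵢ(x)ⱼ = exp((φᵢ(x))ⱼ)/Σ_{k=1}^{c} exp((φᵢ(x))ₖ). Define the cross-entropy objective f(x) = −Σᵢ₌₁ᴺ log pᵢ(x)_{bᵢ} and the generalized Gauss–Newton matrix H(x) = Σᵢ₌₁ᴺ Jᵢ(x)ᵀ·(diag(pᵢ(x)) − pᵢ(x)pᵢ(x)ᵀ)·Jᵢ(x), where Jᵢ(x) ∈ ℝ^{c×n} is the Jacobian of φᵢ at x. Then for every x ∈ ℝⁿ, ‖∇²f(x) − H(x)‖ ≤ 2L·f(x). -/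
open RealInnerProductSpace

theorem ContDiff.differentiable_gradient_s17 {E : Type*} [NormedAddCommGroup E]
    [InnerProductSpace ℝ E] [CompleteSpace E] {g : E → ℝ} (hg : ContDiff ℝ 2 g) :
    Differentiable ℝ (gradient g) :=
  (InnerProductSpace.toDual ℝ E).symm.toContinuousLinearEquiv.differentiable.comp
    ((hg.fderiv_right (m := 1) (by norm_num)).differentiable one_ne_zero)

section Softmax

variable {E ι : Type*} [Fintype ι]

/-- The `j`-th softmax probability of the scores `φ k x`. -/
noncomputable def softmaxProb (φ : ι → E → ℝ) (x : E) (j : ι) : ℝ :=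
  Real.exp (φ j x) / ∑ k, Real.exp (φ k x)

theorem sum_exp_pos [Nonempty ι] (φ : ι → E → ℝ) (x : E) : 0 < ∑ k, Real.exp (φ k x) :=
  Finset.sum_pos (fun _ _ => Real.exp_pos _) Finset.univ_nonempty

theorem softmaxProb_pos [Nonempty ι] (φ : ι → E → ℝ) (x : E) (j : ι) : 0 < softmaxProb φ x j :=
  div_pos (Real.exp_pos _) (sum_exp_pos φ x)

theorem sum_softmaxProb [Nonempty ι] (φ : ι → E → ℝ) (x : E) : ∑ j, softmaxProb φ x j = 1 := by
  simp only [softmaxProb]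
  rw [← Finset.sum_div, div_self (sum_exp_pos φ x).ne']

theorem log_softmaxProb [Nonempty ι] (φ : ι → E → ℝ) (x : E) (j : ι) :
    Real.log (softmaxProb φ x j) = φ j x - Real.log (∑ k, Real.exp (φ k x)) := by
  rw [softmaxProb, Real.log_div (Real.exp_pos _).ne' (sum_exp_pos φ x).ne', Real.log_exp]

variable [NormedAddCommGroup E] [InnerProductSpace ℝ E] [CompleteSpace E]

theorem hasFDerivAt_log_softmaxProb [Nonempty ι] {φ : ι → E → ℝ} {x : E}
    (hφ : ∀ j, DifferentiableAt ℝ (φ j) x) (j : ι) :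
    HasFDerivAt (fun y => Real.log (softmaxProb φ y j))
      (innerSL ℝ (gradient (φ j) x - ∑ k, softmaxProb φ x k • gradient (φ k) x)) x := by
  have hd : ∀ k, HasFDerivAt (φ k) (innerSL ℝ (gradient (φ k) x)) x :=
    fun k => (hφ k).hasGradientAt.hasFDerivAt
  simp only [log_softmaxProb]
  refine ((hd j).sub ((HasFDerivAt.fun_sum fun k (_ : k ∈ Finset.univ) => (hd k).exp).log
    (sum_exp_pos φ x).ne')).congr_fderiv ?_
  ext v
  simp [softmaxProb, Finset.mul_sum, div_eq_inv_mul, mul_assoc]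

theorem hasFDerivAt_softmaxProb [Nonempty ι] {φ : ι → E → ℝ} {x : E}
    (hφ : ∀ j, DifferentiableAt ℝ (φ j) x) (j : ι) :
    HasFDerivAt (fun y => softmaxProb φ y j)
      (softmaxProb φ x j •
        innerSL ℝ (gradient (φ j) x - ∑ k, softmaxProb φ x k • gradient (φ k) x)) x := by
  have h := (hasFDerivAt_log_softmaxProb hφ j).exp
  simpa only [Real.exp_log (softmaxProb_pos φ _ j)] using h

/-- A sum of cross-entropy losses has as gradient the sum of the differences between the
mean score gradients and the label's score gradient. -/
theorem gradient_neg_sum_log_softmaxProb {κ : Type*} [Fintype κ] [Nonempty ι]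
    {φ : κ → ι → E → ℝ} (hφ : ∀ i j, Differentiable ℝ (φ i j)) (b : κ → ι) :
    gradient (fun x => -∑ i, Real.log (softmaxProb (φ i) x (b i))) = fun x =>
      ∑ i, (∑ j, softmaxProb (φ i) x j • gradient (φ i j) x - gradient (φ i (b i)) x) := by
  funext x
  refine HasGradientAt.gradient (hasGradientAt_iff_hasFDerivAt.mpr ?_)
  refine (HasFDerivAt.fun_sum fun i (_ : i ∈ Finset.univ) =>
    hasFDerivAt_log_softmaxProb (fun j => hφ i j x) (b i)).neg.congr_fderiv ?_
  ext v
  simp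

end Softmax

/-- A convex combination of vectors of norm at most `L` differs from the vector indexed by `b`
by at most `-2 L log (w b)`, where `w` are the weights. -/
theorem norm_sum_smul_sub_le_neg_log {ι F : Type*} [Fintype ι] [NormedAddCommGroup F] [NormedSpace ℝ F]
    {w : ι → ℝ} (hw : ∀ j, 0 ≤ w j) (hsum : ∑ j, w j = 1) {A : ι → F} {L : ℝ}
    (hA : ∀ j, ‖A j‖ ≤ L) (b : ι) (hb : 0 < w b) :
    ‖∑ j, w j • A j - A b‖ ≤ 2 * L * -Real.log (w b) := by
  classical
  have hL : 0 ≤ L := (norm_nonneg _).trans (hA b)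
  have hrest : ∑ j ∈ Finset.univ.erase b, w j = 1 - w b := by
    rw [← hsum, ← Finset.add_sum_erase _ w (Finset.mem_univ b)]; ring
  have hle : w b ≤ 1 := by
    rw [← sub_nonneg, ← hrest]; exact Finset.sum_nonneg fun j _ => hw j
  have hsplit : ∑ j, w j • A j - A b
      = ∑ j ∈ Finset.univ.erase b, w j • A j - (1 - w b) • A b := by
    rw [← Finset.add_sum_erase _ (fun j => w j • A j) (Finset.mem_univ b)]; module
  calc ‖∑ j, w j • A j - A b‖
      ≤ ‖∑ j ∈ Finset.univ.erase b, w j • A j‖ + ‖(1 - w b) • A b‖ := hsplit ▸ norm_sub_le _ _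
    _ ≤ ∑ j ∈ Finset.univ.erase b, w j * L + (1 - w b) * L := by
        gcongr
        · refine norm_sum_le_of_le _ fun j _ => ?_
          rw [norm_smul, Real.norm_of_nonneg (hw j)]
          exact mul_le_mul_of_nonneg_left (hA j) (hw j)
        · rw [norm_smul, Real.norm_of_nonneg (sub_nonneg.mpr hle)]
          exact mul_le_mul_of_nonneg_left (hA b) (sub_nonneg.mpr hle)
    _ = 2 * L * (1 - w b) := by rw [← Finset.sum_mul, hrest]; ring
    _ ≤ 2 * L * -Real.log (w b) := by
        gcongr
        linarith [Real.log_le_sub_one_of_pos hb]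

/-- Generalized Gauss–Newton approximation error for the softmax cross-entropy objective:
`‖∇²f(x) − H(x)‖ ≤ 2L f(x)`. Here `φ i j` is the `j`-th component of the `c`-valued model
`φᵢ : ℝⁿ → ℝᶜ`, `p i x j` is the softmax probability, and `H x` is the action of
`Σᵢ Jᵢ(x)ᵀ(diag(pᵢ(x)) − pᵢ(x)pᵢ(x)ᵀ)Jᵢ(x)`. -/
theorem stmt17 {n : ℕ} (N c : ℕ) (hN : 1 ≤ N) (hc : 1 ≤ c) (L : ℝ)
    (φ : Fin N → Fin c → EuclideanSpace ℝ (Fin n) → ℝ) (b : Fin N → Fin c)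
    (hφ : ∀ i j, ContDiff ℝ 2 (φ i j))
    (hHessφ : ∀ i j x, ‖fderiv ℝ (gradient (φ i j)) x‖ ≤ L)
    (p : Fin N → EuclideanSpace ℝ (Fin n) → Fin c → ℝ)
    (hp : ∀ i x j, p i x j = Real.exp (φ i j x) / ∑ k, Real.exp (φ i k x))
    (f : EuclideanSpace ℝ (Fin n) → ℝ)
    (hfdef : ∀ x, f x = -∑ i, Real.log (p i x (b i)))
    (H : EuclideanSpace ℝ (Fin n) →
      EuclideanSpace ℝ (Fin n) →L[ℝ] EuclideanSpace ℝ (Fin n))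
    (hHdef : ∀ x v, H x v = ∑ i, ∑ j,
      (p i x j * ⟪gradient (φ i j) x, v⟫
        - p i x j * ∑ k, p i x k * ⟪gradient (φ i k) x, v⟫) • gradient (φ i j) x) :
    ∀ x, ‖fderiv ℝ (gradient f) x - H x‖ ≤ 2 * L * f x := by
  intro x
  have : Nonempty (Fin c) := ⟨⟨0, hc⟩⟩
  obtain rfl : p = fun i y j => softmaxProb (φ i) y j := by
    funext i y j; exact hp i y j
  obtain rfl : f = fun y => -∑ i, Real.log (softmaxProb (φ i) y (b i)) := funext hfdef
  have hd : ∀ i j, Differentiable ℝ (φ i j) := fun i j => (hφ i j).differentiable two_ne_zero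
  have hg : ∀ i j, HasFDerivAt (gradient (φ i j)) (fderiv ℝ (gradient (φ i j)) x) x :=
    fun i j => ((hφ i j).differentiable_gradient_s17 x).hasFDerivAt
  have hhess := HasFDerivAt.fun_sum fun i (_ : i ∈ Finset.univ) =>
    (HasFDerivAt.fun_sum fun j (_ : j ∈ Finset.univ) =>
      (hasFDerivAt_softmaxProb (fun j => hd i j x) j).smul (hg i j)).sub (hg i (b i))
  have hkey : fderiv ℝ (gradient fun y => -∑ i, Real.log (softmaxProb (φ i) y (b i))) x - H x
      = ∑ i, (∑ j, softmaxProb (φ i) x j • fderiv ℝ (gradient (φ i j)) x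
          - fderiv ℝ (gradient (φ i (b i))) x) := by
    rw [gradient_neg_sum_log_softmaxProb hd, sub_eq_iff_eq_add]
    refine hhess.fderiv.trans ?_
    ext1 v
    simp only [hHdef, add_apply, sub_apply,
      sum_apply, smul_apply,
      ContinuousLinearMap.smulRight_apply, innerSL_apply_apply, inner_sub_left, sum_inner,
      real_inner_smul_left, Finset.sum_add_distrib, Finset.sum_sub_distrib, smul_eq_mul, mul_sub]
    abel
  rw [hkey]
  beta_reduce
  rw [← Finset.sum_neg_distrib, Finset.mul_sum]
  exact norm_sum_le_of_le _ fun i _ => norm_sum_smul_sub_le_neg_log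
    (fun j => (softmaxProb_pos (φ i) x j).le) (sum_softmaxProb (φ i) x)
    (fun j => hHessφ i j x) (b i) (softmaxProb_pos (φ i) x (b i))
end
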